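/- Let γ : [0,S] → ℂ∖ℝ₊ be an arclength-parametrized C^1 simple curve tangentially attached to ℝ₊ (γ(0)=0, γ'(0)=−1), R-regular with ω(R) ≤ 1/5, and let η = √γ be its image in ℍ under the branch of square root mapping ℂ∖ℝ₊ to ℍ. Let t(s) denote the half-plane capacity parametrization (half-plane capacity of η[0,t(s)] equals 2t(s)). Then s/5 ≤ t(s) ≤ s/2 for all s ∈ [0,R]. -/

import Mathlib

open Set Filter Complex

/-- The open upper half-plane, as a subset of `ℂ`. -/
def UHP : Set ℂ := {z : ℂ | 0 < z.im}

/-- `g` is the (hydrodynamically normalized) mapping-out function of the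
compact `ℍ`-hull `K`. -/
def IsMappingOut (K : Set ℂ) (g : ℂ → ℂ) : Prop :=
  DifferentiableOn ℂ g (UHP \ K) ∧ Set.BijOn g (UHP \ K) UHP ∧
    Tendsto (fun z => g z - z)
      (comap (fun z : ℂ => ‖z‖) atTop ⊓ 𝓟 (UHP \ K)) (nhds 0)

/-- The hull `K` has half-plane capacity `a`: its mapping-out function satisfies
`g(z) = z + a/z + o(1/z)`, i.e. `z·(g(z) − z) → a` at infinity. -/
def HasHCap (K : Set ℂ) (a : ℝ) : Prop :=
  ∃ g, IsMappingOut K g ∧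
    Tendsto (fun z => z * (g z - z))
      (comap (fun z : ℂ => ‖z‖) atTop ⊓ 𝓟 (UHP \ K)) (nhds (a : ℂ))

/-- The branch of the square root mapping `ℂ ∖ ℝ₊` into the upper half-plane. -/
noncomputable def sqrtH (z : ℂ) : ℂ := Complex.I * ((-z) ^ ((1:ℂ)/2))

open Metric Topology Real MeasureTheory InnerProductSpace

/-- A continuous function with the mean value property on an open set, asymptotically nonnegative
at the boundary, is nonnegative. -/
theorem nonneg_of_circleAverage_le {Ω : Set ℂ} {u : ℂ → ℝ}
    (hu : ContinuousOn u Ω)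
    (hmean : ∀ z ∈ Ω, ∃ r > 0, closedBall z r ⊆ Ω ∧ circleAverage u z r ≤ u z)
    (hbd : ∀ ε > 0, ∃ C ⊆ Ω, IsCompact C ∧ ∀ z ∈ Ω \ C, -ε < u z) :
    ∀ z ∈ Ω, 0 ≤ u z := by
  intro z₀ hz₀
  by_contra! hneg
  obtain ⟨C, hCΩ, hC, hout⟩ := hbd (-u z₀) (by linarith)
  have hz₀C : z₀ ∈ C := by
    by_contra h
    linarith [hout z₀ ⟨hz₀, h⟩]
  obtain ⟨z₁, hz₁, hmin⟩ := hC.exists_isMinOn ⟨z₀, hz₀C⟩ (hu.mono hCΩ)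
  have hz₁₀ : u z₁ ≤ u z₀ := hmin hz₀C
  have hmin' : ∀ z ∈ Ω, u z₁ ≤ u z := by
    intro z hz
    by_cases h : z ∈ C
    · exact hmin h
    · linarith [hout z ⟨hz, h⟩]
  have hM : IsCompact (C ∩ u ⁻¹' {u z₁}) :=
    hC.of_isClosed_subset ((hu.mono hCΩ).preimage_isClosed_of_isClosed hC.isClosed
      isClosed_singleton) inter_subset_left
  obtain ⟨z₂, ⟨hz₂C, hz₂⟩, hmax⟩ :=
    hM.exists_isMaxOn ⟨z₁, hz₁, rfl⟩ Complex.continuous_re.continuousOn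
  have hz₂ : u z₂ = u z₁ := hz₂
  obtain ⟨r, hr, hball, hmean⟩ := hmean z₂ (hCΩ hz₂C)
  have hcirc : ∀ θ, circleMap z₂ r θ ∈ Ω := fun θ =>
    hball (circleMap_mem_closedBall z₂ hr.le θ)
  have hcont : Continuous fun θ => u (circleMap z₂ r θ) :=
    hu.comp_continuous (continuous_circleMap z₂ r) hcirc
  have hright : u (circleMap z₂ r 0) = u z₁ := by
    by_contra hne
    have hlt : u z₁ < u (circleMap z₂ r 0) := lt_of_le_of_ne (hmin' _ (hcirc 0)) (Ne.symm hne)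
    have hpos : 0 < ∫ θ in (0 : ℝ)..2 * π, (u (circleMap z₂ r θ) - u z₁) := by
      refine intervalIntegral.integral_pos two_pi_pos
        (hcont.sub continuous_const).continuousOn
        (fun θ _ => sub_nonneg.2 (hmin' _ (hcirc θ))) ⟨0, by simp [two_pi_pos.le], sub_pos.2 hlt⟩
    rw [intervalIntegral.integral_sub (hcont.intervalIntegrable _ _) (by simp)] at hpos
    rw [circleAverage_def, smul_eq_mul, hz₂, inv_mul_le_iff₀ two_pi_pos] at hmean
    simp at hpos
    linarith
  have hmem : circleMap z₂ r 0 ∈ C := by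
    by_contra h
    linarith [hout _ ⟨hcirc 0, h⟩]
  have := hmax ⟨hmem, hright⟩
  simp [circleMap] at this
  linarith

theorem isOpen_UHP : IsOpen UHP := isOpen_lt continuous_const Complex.continuous_im

theorem tendsto_mul_I_comap_norm {K : Set ℂ} (hK : Bornology.IsBounded K) :
    Tendsto (fun y : ℝ => (y : ℂ) * I) atTop
      (comap (fun z : ℂ => ‖z‖) atTop ⊓ 𝓟 (UHP \ K)) := by
  obtain ⟨ρ, hρ⟩ := hK.subset_closedBall 0
  refine tendsto_inf.2 ⟨tendsto_comap_iff.2 ?_, tendsto_principal.2 ?_⟩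
  · simpa [Function.comp_def] using tendsto_abs_atTop_atTop
  · filter_upwards [eventually_gt_atTop 0, eventually_gt_atTop ρ] with y hy hyρ
    refine ⟨by simpa [UHP] using hy, fun h => ?_⟩
    have := hρ h
    simp [abs_of_pos hy] at this
    linarith

theorem tendsto_hcap {K : Set ℂ} (hK : Bornology.IsBounded K) {g : ℂ → ℂ} {a : ℝ}
    (ha : Tendsto (fun z => z * (g z - z))
      (comap (fun z : ℂ => ‖z‖) atTop ⊓ 𝓟 (UHP \ K)) (𝓝 (a : ℂ))) :
    Tendsto (fun y : ℝ => y * (y - (g (y * I)).im)) atTop (𝓝 a) := by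
  have := (Complex.continuous_re.tendsto _).comp (ha.comp (tendsto_mul_I_comap_norm hK))
  refine this.congr fun y => ?_
  simp
  ring

theorem exists_forall_norm_gt_of_tendsto {Ω : Set ℂ} {f : ℂ → ℂ}
    (hf : Tendsto f (comap (fun z : ℂ => ‖z‖) atTop ⊓ 𝓟 Ω) (𝓝 0)) {ε : ℝ} (hε : 0 < ε) :
    ∃ M : ℝ, ∀ z ∈ Ω, M < ‖z‖ → ‖f z‖ < ε := by
  have h := hf.norm.eventually_lt_const (by simpa using hε)
  rw [eventually_inf_principal, eventually_comap] at h
  obtain ⟨M, hM⟩ := eventually_atTop.1 h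
  exact ⟨M, fun z hz hzM => hM _ hzM.le z rfl hz⟩

theorem circleAverage_im_eq {Ω : Set ℂ} (hΩ : IsOpen Ω) {g : ℂ → ℂ}
    (hg : DifferentiableOn ℂ g Ω) {z : ℂ} {r : ℝ} (hr : 0 < r) (hball : closedBall z r ⊆ Ω) :
    circleAverage (fun z => (g z).im) z r = (g z).im := by
  refine InnerProductSpace.HarmonicOnNhd.circleAverage_eq fun x hx => ?_
  rw [abs_of_pos hr] at hx
  exact (hg.analyticAt (hΩ.mem_nhds (hball hx))).harmonicAt_im

theorem hcap_le_sq {K : Set ℂ} {ρ : ℝ} (hρ : 0 ≤ ρ) (hK : K ⊆ closedBall 0 ρ) {g : ℂ → ℂ} {a : ℝ}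
    (hg : IsMappingOut K g)
    (ha : Tendsto (fun z => z * (g z - z))
      (comap (fun z : ℂ => ‖z‖) atTop ⊓ 𝓟 (UHP \ K)) (𝓝 (a : ℂ))) :
    a ≤ ρ ^ 2 := by
  obtain ⟨hdiff, hbij, hlim⟩ := hg
  set D : Set ℂ := UHP ∩ {z | ρ < ‖z‖} with hD
  have hDo : IsOpen D := isOpen_UHP.inter (isOpen_lt continuous_const continuous_norm)
  have hDK : D ⊆ UHP \ K := fun z hz => ⟨hz.1, fun h => by
    have := hK h
    have h2 := hz.2
    simp at this h2
    linarith⟩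
  have h0 : ∀ z ∈ D, z ≠ 0 := fun z hz h => by
    have := hz.1
    simp [h, UHP] at this
  have hdiff' : DifferentiableOn ℂ (fun z => g z - (z + ρ ^ 2 / z)) D := by
    refine (hdiff.mono hDK).sub (differentiableOn_id.add ?_)
    exact (differentiableOn_const _).div differentiableOn_id h0
  have him : ∀ z : ℂ, ((ρ : ℂ) ^ 2 / z).im = - (ρ ^ 2 * z.im / ‖z‖ ^ 2) := by
    intro z
    rw [← ofReal_pow, div_eq_mul_inv, Complex.im_ofReal_mul, Complex.inv_im, normSq_eq_norm_sq]
    ring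
  have hpos : ∀ z ∈ D, 0 ≤ (g z - (z + ρ ^ 2 / z)).im := by
    refine nonneg_of_circleAverage_le
      (Complex.continuous_im.comp_continuousOn hdiff'.continuousOn) ?_ ?_
    · intro z hz
      obtain ⟨r, hr, hball⟩ := nhds_basis_closedBall.mem_iff.1 (hDo.mem_nhds hz)
      exact ⟨r, hr, hball, (circleAverage_im_eq hDo hdiff' hr hball).le⟩
    · intro ε hε
      obtain ⟨M, hM⟩ := exists_forall_norm_gt_of_tendsto hlim (half_pos hε)
      set N := max M (2 * ρ ^ 2 / ε) with hN
      refine ⟨{z | ‖z‖ ≤ N} ∩ {z | ρ ≤ ‖z‖} ∩ {z | ε ≤ z.im} ∩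
        {z | ε * ‖z‖ ^ 2 ≤ z.im * (‖z‖ ^ 2 - ρ ^ 2)}, ?_, ?_, ?_⟩
      · rintro z ⟨⟨⟨h1, h2⟩, h3⟩, h4⟩
        simp only [mem_ofPred_eq] at h1 h2 h3 h4
        refine ⟨show 0 < z.im by linarith, lt_of_le_of_ne h2 fun h => ?_⟩
        rw [h] at h4
        have hz : 0 < ‖z‖ := lt_of_lt_of_le (by linarith) (Complex.im_le_norm z)
        have : 0 < ε * ‖z‖ ^ 2 := by positivity
        simp at h4
        linarith
      · refine (isCompact_closedBall (0 : ℂ) N).of_isClosed_subset ?_ ?_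
        · refine ((IsClosed.inter ?_ ?_).inter ?_).inter ?_ <;>
            exact isClosed_le (by fun_prop) (by fun_prop)
        · rintro z ⟨⟨⟨h1, h2⟩, h3⟩, h4⟩
          simpa using h1
      · rintro z ⟨hz, hzC⟩
        have hz0 : 0 < ‖z‖ := norm_pos_iff.2 (h0 z hz)
        have hgz : 0 < (g z).im := hbij.mapsTo (hDK hz)
        have hzim : 0 < z.im := hz.1
        have hzρ : ρ < ‖z‖ := hz.2
        rw [sub_im, add_im, him]
        by_cases hzN : ‖z‖ ≤ N
        · have key : z.im * (‖z‖ ^ 2 - ρ ^ 2) < ε * ‖z‖ ^ 2 := by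
            by_contra! h
            refine hzC ⟨⟨⟨hzN, hzρ.le⟩, ?_⟩, h⟩
            have : ε * ‖z‖ ^ 2 ≤ z.im * ‖z‖ ^ 2 := by nlinarith [mul_nonneg hzim.le (sq_nonneg ρ)]
            exact le_of_mul_le_mul_right this (by positivity)
          have : z.im + -(ρ ^ 2 * z.im / ‖z‖ ^ 2) < ε := by
            have : z.im + -(ρ ^ 2 * z.im / ‖z‖ ^ 2) = z.im * (‖z‖ ^ 2 - ρ ^ 2) / ‖z‖ ^ 2 := by
              field_simp
              ring
            rw [this, div_lt_iff₀ (by positivity)]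
            exact key
          linarith
        · push Not at hzN
          have h1 := hM z (hDK hz) (lt_of_le_of_lt (le_max_left _ _) hzN)
          have h2 := (abs_lt.1 ((Complex.abs_im_le_norm _).trans_lt h1)).1
          rw [sub_im] at h2
          have : 0 ≤ ρ ^ 2 * z.im / ‖z‖ ^ 2 := by positivity
          linarith
  refine le_of_tendsto (tendsto_hcap (isBounded_closedBall.subset hK) ha) ?_
  filter_upwards [eventually_gt_atTop ρ] with y hy
  have hy0 : 0 < y := hρ.trans_lt hy
  have := hpos (y * I) ⟨by simpa [UHP] using hy0, by simpa [abs_of_pos hy0] using hy⟩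
  rw [sub_im, add_im, him] at this
  simp [abs_of_pos hy0] at this
  have h2 : ρ ^ 2 * y / y ^ 2 * y = ρ ^ 2 := by field_simp
  nlinarith

theorem nhds_le_map_nhds_of_injOn {Ω : Set ℂ} (hΩ : IsOpen Ω) {g : ℂ → ℂ}
    (hg : DifferentiableOn ℂ g Ω) (hinj : InjOn g Ω) {z : ℂ} (hz : z ∈ Ω) :
    𝓝 (g z) ≤ map g (𝓝 z) := by
  refine ((hg.analyticAt (hΩ.mem_nhds hz)).eventually_constant_or_nhds_le_map_nhds).resolve_left
    fun h => ?_
  have h2 : ∀ᶠ w in 𝓝 z, w = z := by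
    filter_upwards [h, hΩ.mem_nhds hz] with w hw hwΩ
    exact hinj hwΩ hz hw
  have h3 : ∀ᶠ w in 𝓝[≠] z, False := by
    filter_upwards [h2.filter_mono nhdsWithin_le_nhds, self_mem_nhdsWithin] with w hw hw'
    exact hw' hw
  exact (h3.exists).elim fun _ h => h

theorem continuousAt_invFunOn {Ω : Set ℂ} (hΩ : IsOpen Ω) {g : ℂ → ℂ}
    (hg : DifferentiableOn ℂ g Ω) (hinj : InjOn g Ω) {w : ℂ} (hw : w ∈ g '' Ω) :
    ContinuousAt (Function.invFunOn g Ω) w := by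
  obtain ⟨z, hz, rfl⟩ := hw
  have hleft := hinj.leftInvOn_invFunOn
  rw [ContinuousAt, hleft hz]
  refine (tendsto_map'_iff.2 ?_).mono_left (nhds_le_map_nhds_of_injOn hΩ hg hinj hz)
  refine tendsto_id.congr' ?_
  filter_upwards [hΩ.mem_nhds hz] with x hx
  exact (hleft hx).symm

theorem isPreconnected_UHP_inter_norm_gt {N : ℝ} (hN : 0 < N) :
    IsPreconnected (UHP ∩ {w : ℂ | N < ‖w‖}) := by
  have : UHP ∩ {w : ℂ | N < ‖w‖} =
      Complex.exp '' (Complex.re ⁻¹' Ioi (Real.log N) ∩ Complex.im ⁻¹' Ioo 0 π) := by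
    ext w
    constructor
    · rintro ⟨h1, h2⟩
      have hw : w ≠ 0 := norm_pos_iff.1 (hN.trans h2)
      refine ⟨Complex.log w, ⟨?_, ?_⟩, Complex.exp_log hw⟩
      · simpa [Complex.log_re] using Real.log_lt_log hN h2
      · have h1 : 0 < w.im := h1
        simp only [mem_preimage, Complex.log_im, mem_Ioo]
        refine ⟨lt_of_le_of_ne (Complex.arg_nonneg_iff.2 h1.le) fun h => ?_,
          lt_of_le_of_ne (Complex.arg_le_pi w) fun h => ?_⟩
        · exact h1.ne' (Complex.arg_eq_zero_iff.1 h.symm).2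
        · exact h1.ne' (Complex.arg_eq_pi_iff.1 h).2
    · rintro ⟨z, ⟨h1, h2⟩, rfl⟩
      refine ⟨?_, ?_⟩
      · show 0 < (Complex.exp z).im
        rw [Complex.exp_im]
        exact mul_pos (Real.exp_pos _) (Real.sin_pos_of_mem_Ioo h2)
      · show N < ‖Complex.exp z‖
        rw [Complex.norm_exp]
        exact (Real.log_lt_iff_lt_exp hN).1 h1
  rw [this]
  refine IsPreconnected.image ?_ _ Complex.continuous_exp.continuousOn
  refine Convex.isPreconnected (Convex.inter ?_ ?_)
  · exact (convex_Ioi _).is_linear_preimage Complex.reLm.isLinear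
  · exact (convex_Ioo _ _).is_linear_preimage Complex.imLm.isLinear

theorem IsMappingOut.exists_forall_norm_gt {K : Set ℂ} (hK : IsCompact K) {g : ℂ → ℂ}
    (hg : IsMappingOut K g) (M : ℝ) :
    ∃ N : ℝ, ∀ z ∈ UHP \ K, N < ‖g z‖ → M < ‖z‖ := by
  obtain ⟨hdiff, hbij, hlim⟩ := hg
  have hΩ : IsOpen (UHP \ K) := isOpen_UHP.sdiff hK.isClosed
  obtain ⟨M₁, hM₁⟩ := exists_forall_norm_gt_of_tendsto hlim one_pos
  obtain ⟨M₂, hM₂⟩ := hK.isBounded.subset_closedBall 0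
  set M₀ := max (max M M₁) (max M₂ 0) with hM₀
  have hMM : M ≤ M₀ := by simp [hM₀]
  have hM₁M : M₁ ≤ M₀ := by simp [hM₀]
  have hM₂M : M₂ ≤ M₀ := by simp [hM₀]
  have hM₀0 : 0 ≤ M₀ := by simp [hM₀]
  set E := (UHP \ K) ∩ {z | M₀ < ‖z‖} with hE
  have hEo : IsOpen E := hΩ.inter (isOpen_lt continuous_const continuous_norm)
  have hclose : ∀ z ∈ E, ‖g z - z‖ < 1 := fun z hz => hM₁ z hz.1 (hM₁M.trans_lt hz.2)
  have hBo : IsOpen (g '' E) := by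
    rw [isOpen_iff_mem_nhds]
    rintro _ ⟨z, hz, rfl⟩
    exact nhds_le_map_nhds_of_injOn hΩ hdiff hbij.injOn hz.1 (image_mem_map (hEo.mem_nhds hz))
  have hAo : IsOpen {w : ℂ | M₀ + 2 < ‖w‖} := isOpen_lt continuous_const continuous_norm
  have hsub : UHP ∩ {w : ℂ | M₀ + 2 < ‖w‖} ⊆ g '' E := by
    refine (isPreconnected_UHP_inter_norm_gt (by linarith)).subset_of_closure_inter_subset hBo ?_ ?_
    · have hmem : ((M₀ + 4 : ℝ) : ℂ) * I ∈ E := by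
        refine ⟨⟨?_, fun h => ?_⟩, ?_⟩
        · show 0 < (((M₀ + 4 : ℝ) : ℂ) * I).im
          rw [Complex.im_ofReal_mul, I_im]
          linarith
        · have := hM₂ h
          rw [mem_closedBall_zero_iff, norm_mul, norm_I, mul_one, norm_real, Real.norm_eq_abs,
            abs_of_pos (by linarith)] at this
          linarith
        · show M₀ < ‖((M₀ + 4 : ℝ) : ℂ) * I‖
          rw [norm_mul, norm_I, mul_one, norm_real, Real.norm_eq_abs, abs_of_pos (by linarith)]
          linarith
      refine ⟨_, ⟨hbij.mapsTo hmem.1, ?_⟩, mem_image_of_mem g hmem⟩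
      have h1 := hclose _ hmem
      have h2 := norm_sub_norm_le (((M₀ + 4 : ℝ) : ℂ) * I) (g (((M₀ + 4 : ℝ) : ℂ) * I))
      rw [norm_sub_rev] at h2
      have h3 : ‖((M₀ + 4 : ℝ) : ℂ) * I‖ = M₀ + 4 := by
        rw [norm_mul, norm_I, mul_one, norm_real, Real.norm_eq_abs, abs_of_pos (by linarith)]
      show M₀ + 2 < ‖g (((M₀ + 4 : ℝ) : ℂ) * I)‖
      linarith
    · rintro w ⟨hwB, hwU, hwN⟩
      have himg : w ∈ g '' (UHP \ K) := hbij.surjOn hwU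
      have hw' : w ∈ closure ({w : ℂ | M₀ + 2 < ‖w‖} ∩ g '' E) :=
        hAo.inter_closure ⟨hwN, hwB⟩
      have hcl := mem_closure_image
        (continuousAt_invFunOn hΩ hdiff hbij.injOn himg) hw'
      have hle : M₀ + 1 ≤ ‖Function.invFunOn g (UHP \ K) w‖ := by
        have hcls : IsClosed {z : ℂ | M₀ + 1 ≤ ‖z‖} := isClosed_le continuous_const continuous_norm
        refine hcls.closure_subset_iff.2 ?_ hcl
        rintro _ ⟨_, ⟨hN, z, hz, rfl⟩, rfl⟩
        rw [hbij.injOn.leftInvOn_invFunOn hz.1]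
        have h1 := hclose z hz
        have h2 := norm_sub_norm_le (g z) z
        have h3 : M₀ + 2 < ‖g z‖ := hN
        show M₀ + 1 ≤ ‖z‖
        linarith
      exact ⟨_, ⟨Function.invFunOn_mem himg, show M₀ < _ by linarith⟩,
        Function.invFunOn_eq himg⟩
  refine ⟨M₀ + 2, fun z hz hzN => ?_⟩
  obtain ⟨z', hz', heq⟩ := hsub ⟨hbij.mapsTo hz, hzN⟩
  rw [← hbij.injOn hz'.1 hz heq]
  exact hMM.trans_lt hz'.2

theorem IsMappingOut.exists_isCompact {K : Set ℂ} (hK : IsCompact K) {g : ℂ → ℂ}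
    (hg : IsMappingOut K g) {ε : ℝ} (hε : 0 < ε) (M : ℝ) :
    ∃ C ⊆ UHP \ K, IsCompact C ∧ ∀ z ∈ (UHP \ K) \ C, (g z).im < ε ∨ M < ‖z‖ := by
  obtain ⟨N, hN⟩ := hg.exists_forall_norm_gt hK M
  obtain ⟨hdiff, hbij, -⟩ := hg
  have hΩ : IsOpen (UHP \ K) := isOpen_UHP.sdiff hK.isClosed
  set T : Set ℂ := closedBall 0 N ∩ {w | ε ≤ w.im} with hT
  have hTU : T ⊆ g '' (UHP \ K) := fun w hw => hbij.surjOn (show 0 < w.im from hε.trans_le hw.2)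
  have hTc : IsCompact T :=
    (isCompact_closedBall _ _).inter_right (isClosed_le continuous_const Complex.continuous_im)
  refine ⟨Function.invFunOn g (UHP \ K) '' T, ?_, hTc.image_of_continuousOn fun w hw =>
    (continuousAt_invFunOn hΩ hdiff hbij.injOn (hTU hw)).continuousWithinAt, ?_⟩
  · rintro _ ⟨w, hw, rfl⟩
    exact Function.invFunOn_mem (hTU hw)
  · rintro z ⟨hz, hzC⟩
    by_contra! h
    refine hzC ⟨g z, ⟨?_, h.1⟩, hbij.injOn.leftInvOn_invFunOn hz⟩
    rw [mem_closedBall_zero_iff]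
    by_contra! h2
    exact absurd (hN z hz h2) (not_lt.2 h.2)

/-- The Green function of the upper half-plane. -/
noncomputable def greenUHP (z w : ℂ) : ℝ :=
  Real.log ‖z - (starRingEnd ℂ) w‖ - Real.log ‖z - w‖

theorem sq_norm_sub_conj (z w : ℂ) :
    ‖z - (starRingEnd ℂ) w‖ ^ 2 = ‖z - w‖ ^ 2 + 4 * z.im * w.im := by
  rw [← normSq_eq_norm_sq, ← normSq_eq_norm_sq, normSq_apply, normSq_apply]
  simp
  ring

theorem norm_sub_le_norm_sub_conj {z w : ℂ} (hz : 0 ≤ z.im) (hw : 0 ≤ w.im) :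
    ‖z - w‖ ≤ ‖z - (starRingEnd ℂ) w‖ := by
  refine le_of_sq_le_sq ?_ (norm_nonneg _)
  rw [sq_norm_sub_conj]
  have := mul_nonneg hz hw
  linarith

theorem greenUHP_nonneg {z w : ℂ} (hz : 0 ≤ z.im) (hw : 0 ≤ w.im) (hzw : z ≠ w) :
    0 ≤ greenUHP z w :=
  sub_nonneg.2 (Real.log_le_log (norm_pos_iff.2 (sub_ne_zero.2 hzw))
    (norm_sub_le_norm_sub_conj hz hw))

theorem greenUHP_le {z w : ℂ} (hz : 0 ≤ z.im) (hw : 0 ≤ w.im) (hzw : z ≠ w) :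
    greenUHP z w ≤ 2 * w.im / ‖z - w‖ := by
  have h0 : 0 < ‖z - w‖ := norm_pos_iff.2 (sub_ne_zero.2 hzw)
  have h1 : 0 < ‖z - (starRingEnd ℂ) w‖ := h0.trans_le (norm_sub_le_norm_sub_conj hz hw)
  rw [greenUHP, ← Real.log_div h1.ne' h0.ne']
  refine (Real.log_le_sub_one_of_pos (by positivity)).trans ?_
  rw [div_sub_one h0.ne']
  gcongr
  have h2 := norm_sub_norm_le (z - (starRingEnd ℂ) w) (z - w)
  have h3 : z - (starRingEnd ℂ) w - (z - w) = ((2 * w.im : ℝ) : ℂ) * I := by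
    rw [sub_sub_sub_cancel_left, Complex.sub_conj]
  rwa [h3, norm_mul, norm_I, mul_one, norm_real, Real.norm_eq_abs, abs_of_nonneg (by linarith)]
    at h2

theorem le_greenUHP_mul_I {y M : ℝ} {w : ℂ} (hy : 0 < y) (hw : 0 ≤ w.im) (hwM : ‖w‖ ≤ M)
    (hMy : M < y) : 2 * y / (y + M) ^ 2 * w.im ≤ greenUHP (y * I) w := by
  have hyn : ‖(y : ℂ) * I‖ = y := by simp [abs_of_pos hy]
  have hM : 0 ≤ M := (norm_nonneg _).trans hwM
  have hzim : ((y : ℂ) * I).im = y := by simp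
  have h0 : 0 < ‖(y : ℂ) * I - w‖ := by
    have := norm_sub_norm_le ((y : ℂ) * I) w
    linarith
  have h1 : 0 < ‖(y : ℂ) * I - (starRingEnd ℂ) w‖ :=
    h0.trans_le (norm_sub_le_norm_sub_conj (by rw [hzim]; exact hy.le) hw)
  have hA : ‖(y : ℂ) * I - (starRingEnd ℂ) w‖ ≤ y + M := by
    have := norm_sub_le ((y : ℂ) * I) ((starRingEnd ℂ) w)
    rw [RCLike.norm_conj] at this
    linarith
  have hsq := sq_norm_sub_conj ((y : ℂ) * I) w
  rw [hzim] at hsq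
  set A := ‖(y : ℂ) * I - (starRingEnd ℂ) w‖
  set B := ‖(y : ℂ) * I - w‖
  have key := Real.log_le_sub_one_of_pos (show 0 < B ^ 2 / A ^ 2 by positivity)
  rw [Real.log_div (by positivity) (by positivity), Real.log_pow, Real.log_pow] at key
  have h2 : B ^ 2 / A ^ 2 - 1 = - (2 * (2 * y / A ^ 2 * w.im)) := by
    field_simp
    linarith
  have h3 : 2 * y / (y + M) ^ 2 * w.im ≤ 2 * y / A ^ 2 * w.im := by gcongr
  push_cast at key
  show _ ≤ Real.log A - Real.log B
  linarith

theorem harmonicAt_greenUHP {z w : ℂ} (h1 : z ≠ (starRingEnd ℂ) w) (h2 : z ≠ w) :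
    HarmonicAt (fun z => greenUHP z w) z :=
  (AnalyticAt.harmonicAt_log_norm (f := fun z => z - (starRingEnd ℂ) w) (by fun_prop)
    (sub_ne_zero.2 h1)).sub
    (AnalyticAt.harmonicAt_log_norm (f := fun z => z - w) (by fun_prop) (sub_ne_zero.2 h2))

theorem continuousAt_greenUHP {z w : ℂ} (h1 : z ≠ (starRingEnd ℂ) w) (h2 : z ≠ w) :
    ContinuousAt (fun z => greenUHP z w) z := by
  unfold greenUHP
  have h1 := norm_ne_zero_iff.2 (sub_ne_zero.2 h1)
  have h2 := norm_ne_zero_iff.2 (sub_ne_zero.2 h2)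
  fun_prop (disch := assumption)

theorem measurable_greenUHP : Measurable fun p : ℂ × ℂ => greenUHP p.1 p.2 := by
  unfold greenUHP
  have : Measurable (starRingEnd ℂ) := Complex.continuous_conj.measurable
  fun_prop

theorem ne_conj_of_mem_UHP {z w : ℂ} (hz : z ∈ UHP) (hw : 0 ≤ w.im) :
    z ≠ (starRingEnd ℂ) w := by
  rintro rfl
  have h : 0 < ((starRingEnd ℂ) w).im := hz
  rw [Complex.conj_im] at h
  linarith

theorem abs_greenUHP_le_of_closedBall {α : Type*} {w : α → ℂ} {K : Set ℂ} {M : ℝ} (hKM : K ⊆ closedBall 0 M)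
    (hwK : ∀ x, w x ∈ K) (him : ∀ x, 0 ≤ (w x).im) {z₀ : ℂ} {r : ℝ} (hr : 0 < r)
    (hball : closedBall z₀ (2 * r) ⊆ UHP \ K) {z : ℂ} (hz : z ∈ closedBall z₀ r) (x : α) :
    |greenUHP z (w x)| ≤ 2 * M / r := by
  have hzΩ : z ∈ UHP \ K := hball (closedBall_subset_closedBall (by linarith) hz)
  have hzim : 0 ≤ z.im := (show 0 < z.im from hzΩ.1).le
  have hne : z ≠ w x := fun h => hzΩ.2 (h ▸ hwK x)
  have hdist : r ≤ ‖z - w x‖ := by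
    by_contra! h
    refine (hball (?_ : w x ∈ closedBall z₀ (2 * r))).2 (hwK x)
    rw [mem_closedBall, dist_comm]
    rw [mem_closedBall, dist_comm] at hz
    have := dist_triangle z₀ z (w x)
    rw [dist_eq_norm z] at this
    linarith
  have hwM : (w x).im ≤ M :=
    (Complex.im_le_norm _).trans (mem_closedBall_zero_iff.1 (hKM (hwK x)))
  rw [abs_of_nonneg (greenUHP_nonneg hzim (him x) hne)]
  refine (greenUHP_le hzim (him x) hne).trans ?_
  have h0 := him x
  have hM0 : 0 ≤ M := h0.trans hwM
  gcongr

section Potential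

variable {α : Type*} [MeasurableSpace α] {m : Measure α} [IsFiniteMeasure m] {w : α → ℂ}
  {K : Set ℂ} {M : ℝ}

theorem integrable_greenUHP (hK : IsCompact K) (hw : Measurable w) (hwK : ∀ x, w x ∈ K)
    (him : ∀ x, 0 ≤ (w x).im) {z : ℂ} (hz : z ∈ UHP \ K) :
    Integrable (fun x => greenUHP z (w x)) m := by
  obtain ⟨M, hM⟩ := hK.isBounded.subset_closedBall 0
  obtain ⟨δ, hδ, hball⟩ :=
    nhds_basis_closedBall.mem_iff.1 ((isOpen_UHP.sdiff hK.isClosed).mem_nhds hz)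
  refine Integrable.of_bound
    (measurable_greenUHP.comp (measurable_const.prodMk hw)).aestronglyMeasurable
    (2 * M / (δ / 2)) (ae_of_all _ fun x => ?_)
  exact abs_greenUHP_le_of_closedBall hM hwK him (half_pos hδ)
    (by rwa [mul_div_cancel₀ _ two_ne_zero]) (mem_closedBall_self (half_pos hδ).le) x

theorem continuousOn_integral_greenUHP (hK : IsCompact K) (hw : Measurable w) (hwK : ∀ x, w x ∈ K)
    (him : ∀ x, 0 ≤ (w x).im) :
    ContinuousOn (fun z => ∫ x, greenUHP z (w x) ∂m) (UHP \ K) := by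
  intro z hz
  obtain ⟨M, hM⟩ := hK.isBounded.subset_closedBall 0
  obtain ⟨δ, hδ, hball⟩ :=
    nhds_basis_closedBall.mem_iff.1 ((isOpen_UHP.sdiff hK.isClosed).mem_nhds hz)
  refine (continuousAt_of_dominated (bound := fun _ => 2 * M / (δ / 2)) ?_ ?_
    (integrable_const _) ?_).continuousWithinAt
  · exact Eventually.of_forall fun z =>
      (measurable_greenUHP.comp (measurable_const.prodMk hw)).aestronglyMeasurable
  · filter_upwards [closedBall_mem_nhds z (half_pos hδ)] with z' hz'
    exact ae_of_all _ fun x => abs_greenUHP_le_of_closedBall hM hwK him (half_pos hδ)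
      (by rwa [mul_div_cancel₀ _ two_ne_zero]) hz' x
  · exact ae_of_all _ fun x => continuousAt_greenUHP (ne_conj_of_mem_UHP hz.1 (him x))
      fun h => hz.2 (h ▸ hwK x)

theorem circleAverage_integral_greenUHP (hKM : K ⊆ closedBall 0 M) (hw : Measurable w)
    (hwK : ∀ x, w x ∈ K) (him : ∀ x, 0 ≤ (w x).im) {z : ℂ} {r : ℝ} (hr : 0 < r)
    (hball : closedBall z (2 * r) ⊆ UHP \ K) :
    circleAverage (fun z => ∫ x, greenUHP z (w x) ∂m) z r = ∫ x, greenUHP z (w x) ∂m := by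
  have hx : ∀ x, circleAverage (fun z => greenUHP z (w x)) z r = greenUHP z (w x) := by
    intro x
    refine InnerProductSpace.HarmonicOnNhd.circleAverage_eq fun y hy => ?_
    rw [abs_of_pos hr] at hy
    have hyΩ := hball (closedBall_subset_closedBall (by linarith) hy)
    exact harmonicAt_greenUHP (ne_conj_of_mem_UHP hyΩ.1 (him x)) fun h => hyΩ.2 (h ▸ hwK x)
  simp_rw [circleAverage_def, smul_eq_mul] at hx ⊢
  rw [intervalIntegral.integral_of_le two_pi_pos.le, integral_integral_swap, ← integral_const_mul]
  · refine integral_congr_ae (ae_of_all _ fun x => ?_)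
    simp only
    rw [← intervalIntegral.integral_of_le two_pi_pos.le, hx]
  · refine Integrable.of_bound (Measurable.aestronglyMeasurable ?_) (2 * M / r)
      (ae_of_all _ fun p => ?_)
    · exact measurable_greenUHP.comp
        (((continuous_circleMap z r).measurable.comp measurable_fst).prodMk
          (hw.comp measurable_snd))
    · exact abs_greenUHP_le_of_closedBall hKM hwK him hr hball
        (circleMap_mem_closedBall z hr.le p.1) p.2

/-- If the Green potential of a measure carried by the hull `K` is at most `Im z`, then
the half-plane capacity of `K` is at least twice the first moment of the heights. -/
theorem two_mul_integral_im_le_hcap (hK : IsCompact K) (hw : Measurable w) (hwK : ∀ x, w x ∈ K)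
    (him : ∀ x, 0 ≤ (w x).im)
    (hpot : ∀ z ∈ UHP \ K, ∫ x, greenUHP z (w x) ∂m ≤ z.im) {g : ℂ → ℂ} {a : ℝ}
    (hg : IsMappingOut K g)
    (ha : Tendsto (fun z => z * (g z - z))
      (comap (fun z : ℂ => ‖z‖) atTop ⊓ 𝓟 (UHP \ K)) (𝓝 (a : ℂ))) :
    2 * ∫ x, (w x).im ∂m ≤ a := by
  obtain ⟨M, hM⟩ := hK.isBounded.subset_closedBall 0
  have hwM : ∀ x, ‖w x‖ ≤ M := fun x => mem_closedBall_zero_iff.1 (hM (hwK x))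
  have hwiM : ∀ x, (w x).im ≤ M := fun x => (Complex.im_le_norm _).trans (hwM x)
  have hΩ : IsOpen (UHP \ K) := isOpen_UHP.sdiff hK.isClosed
  have hcomp := fun ε (hε : (0 : ℝ) < ε) N => hg.exists_isCompact hK hε N
  obtain ⟨hdiff, hbij, hlim⟩ := hg
  have hd : DifferentiableOn ℂ (fun z => z - g z) (UHP \ K) := differentiableOn_id.sub hdiff
  have hQc := continuousOn_integral_greenUHP (m := m) hK hw hwK him
  have hpos : ∀ z ∈ UHP \ K, 0 ≤ (z - g z).im - ∫ x, greenUHP z (w x) ∂m := by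
    refine nonneg_of_circleAverage_le
      ((Complex.continuous_im.comp_continuousOn hd.continuousOn).sub hQc) ?_ ?_
    · intro z hz
      obtain ⟨δ, hδ, hball⟩ := nhds_basis_closedBall.mem_iff.1 (hΩ.mem_nhds hz)
      have hball' : closedBall z (δ / 2) ⊆ UHP \ K :=
        (closedBall_subset_closedBall (by linarith)).trans hball
      have hsph : sphere z |δ / 2| ⊆ UHP \ K := by
        rw [abs_of_pos (half_pos hδ)]
        exact sphere_subset_closedBall.trans hball'
      refine ⟨δ / 2, half_pos hδ, hball', ?_⟩
      rw [circleAverage_fun_sub (f₁ := fun z => (z - g z).im)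
        ((Complex.continuous_im.comp_continuousOn hd.continuousOn).mono hsph).circleIntegrable'
        (hQc.mono hsph).circleIntegrable', circleAverage_im_eq hΩ hd (half_pos hδ) hball',
        circleAverage_integral_greenUHP hM hw hwK him (half_pos hδ)
          (by rwa [mul_div_cancel₀ _ two_ne_zero])]
    · intro ε hε
      obtain ⟨N₁, hN₁⟩ := exists_forall_norm_gt_of_tendsto hlim (half_pos hε)
      obtain ⟨C, hCΩ, hC, hout⟩ := hcomp ε hε
        (max N₁ (M + 4 * |M| * m.real univ / ε))
      refine ⟨C, hCΩ, hC, fun z hz => ?_⟩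
      have hzΩ := hz.1
      have hzim : 0 < z.im := hzΩ.1
      rw [sub_im]
      rcases hout z hz with h | h
      · linarith [hpot z hzΩ]
      · have h1 := hN₁ z hzΩ ((le_max_left _ _).trans_lt h)
        have h2 := (abs_lt.1 ((Complex.abs_im_le_norm _).trans_lt h1)).2
        rw [sub_im] at h2
        have h3 : M + 4 * |M| * m.real univ / ε < ‖z‖ := (le_max_right _ _).trans_lt h
        have h4 : 0 ≤ 4 * |M| * m.real univ / ε := by positivity
        have h5 : 0 < ‖z‖ - M := by linarith
        have h6 : ∫ x, greenUHP z (w x) ∂m ≤ ∫ x, 2 * |M| / (‖z‖ - M) ∂m := by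
          refine integral_mono (integrable_greenUHP hK hw hwK him hzΩ) (integrable_const _)
            fun x => ?_
          have hne : z ≠ w x := fun h => hzΩ.2 (h ▸ hwK x)
          refine (greenUHP_le hzim.le (him x) hne).trans ?_
          have h7 := norm_sub_norm_le z (w x)
          have h8 := hwM x
          have h9 := (hwiM x).trans (le_abs_self M)
          have := him x
          gcongr
          linarith
        have h7 : ∫ x, 2 * |M| / (‖z‖ - M) ∂m ≤ ε / 2 := by
          rw [integral_const, smul_eq_mul, mul_div_assoc', div_le_iff₀ h5]
          have : 4 * |M| * m.real univ / ε < ‖z‖ - M := by linarith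
          rw [div_lt_iff₀ hε] at this
          linarith
        linarith
  have hlim2 : Tendsto (fun y : ℝ => (1 - M / (y + M)) ^ 2 * (2 * ∫ x, (w x).im ∂m)) atTop
      (𝓝 (2 * ∫ x, (w x).im ∂m)) := by
    have h1 : Tendsto (fun y : ℝ => M / (y + M)) atTop (𝓝 0) :=
      (tendsto_atTop_add_const_right _ _ tendsto_id).const_div_atTop M
    simpa using ((h1.const_sub 1).pow 2).mul_const (2 * ∫ x, (w x).im ∂m)
  refine le_of_tendsto_of_tendsto hlim2 (tendsto_hcap hK.isBounded ha) ?_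
  filter_upwards [eventually_gt_atTop (0 : ℝ), eventually_gt_atTop M, eventually_gt_atTop (-M)]
    with y hy hyM hyM'
  have hyΩ : (y : ℂ) * I ∈ UHP \ K := by
    refine ⟨by simpa [UHP] using hy, fun h => ?_⟩
    have := mem_closedBall_zero_iff.1 (hM h)
    simp [abs_of_pos hy] at this
    linarith
  have h1 := hpos _ hyΩ
  have h2 : ∫ x, 2 * y / (y + M) ^ 2 * (w x).im ∂m ≤ ∫ x, greenUHP (y * I) (w x) ∂m := by
    refine integral_mono (Integrable.const_mul ?_ _) (integrable_greenUHP hK hw hwK him hyΩ)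
      fun x => le_greenUHP_mul_I hy (him x) (hwM x) hyM
    refine Integrable.of_bound (Complex.measurable_im.comp hw).aestronglyMeasurable M
      (ae_of_all _ fun x => ?_)
    rw [Real.norm_of_nonneg (him x)]
    exact hwiM x
  rw [integral_const_mul] at h2
  rw [sub_im, im_ofReal_mul, I_im, mul_one] at h1
  have h3 : (1 - M / (y + M)) ^ 2 * (2 * ∫ x, (w x).im ∂m) =
      y * (2 * y / (y + M) ^ 2 * ∫ x, (w x).im ∂m) := by
    have : y + M ≠ 0 := by linarith
    field_simp
    ring
  rw [h3]
  gcongr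
  linarith

end Potential

theorem one_sub_sq_mul_log_le {y : ℝ} (h0 : 0 ≤ y) (h1 : y < 1) :
    (1 - y ^ 2) * (Real.log (1 + y) - Real.log (1 - y)) ≤ 2 * y - 4 / 3 * y ^ 3 := by
  have hpos : ∀ x ∈ Ico (0 : ℝ) 1, 0 < 1 - x ^ 2 := fun x hx => by nlinarith [hx.1, hx.2]
  have hder : ∀ x ∈ Ico (0 : ℝ) 1, HasDerivAt
      (fun x => (2 * x - 4 / 3 * x ^ 3) / (1 - x ^ 2) - (Real.log (1 + x) - Real.log (1 - x)))
      (4 / 3 * x ^ 4 / (1 - x ^ 2) ^ 2) x := by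
    intro x hx
    have hx1 : 1 + x ≠ 0 := by linarith [hx.1]
    have hx2 : 1 - x ≠ 0 := by linarith [hx.2]
    have hx3 := (hpos x hx).ne'
    have hA := (((hasDerivAt_id x).const_mul 2).sub (((hasDerivAt_id x).pow 3).const_mul (4 / 3))).div
      (((hasDerivAt_id x).pow 2).const_sub 1) hx3
    have hB := (((hasDerivAt_id x).const_add 1).log hx1).sub
      (((hasDerivAt_id x).const_sub 1).log hx2)
    refine (hA.sub hB).congr_deriv ?_
    simp only [id]
    have hx4 : 1 - x ^ 2 = (1 + x) * (1 - x) := by ring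
    simp only [Pi.sub_apply, Pi.pow_apply, id, hx4]
    field_simp
    ring
  have hmono : MonotoneOn
      (fun x => (2 * x - 4 / 3 * x ^ 3) / (1 - x ^ 2) - (Real.log (1 + x) - Real.log (1 - x)))
      (Ico 0 1) := by
    refine monotoneOn_of_hasDerivWithinAt_nonneg (convex_Ico 0 1)
      (fun x hx => (hder x hx).continuousAt.continuousWithinAt)
      (fun x hx => (hder x (interior_subset hx)).hasDerivWithinAt) (fun x _ => by positivity)
  have h := hmono ⟨le_rfl, one_pos⟩ ⟨h0, h1⟩ h0
  have hp := hpos y ⟨h0, h1⟩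
  simp at h
  rw [← sub_le_iff_le_add, le_div_iff₀ hp] at h
  linarith

theorem intervalIntegrable_log_sub_log (y : ℝ) :
    IntervalIntegrable (fun x => (2 * x + 4 * x ^ 3) / 7 * (Real.log (y + x) - Real.log (y - x)))
      volume 0 1 := by
  have h1 : IntervalIntegrable (fun x => Real.log (y + x)) volume 0 1 := by
    have := (intervalIntegral.intervalIntegrable_log' (a := y + 0) (b := y + 1)).comp_add_left y
    simpa using this
  have h2 : IntervalIntegrable (fun x => Real.log (y - x)) volume 0 1 := by
    have := (intervalIntegral.intervalIntegrable_log' (a := y - 0) (b := y - 1)).comp_sub_left y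
    simpa using this
  exact (h1.sub h2).continuousOn_mul (by fun_prop)

theorem integral_log_sub_log {y : ℝ} (hy : 0 < y) :
    ∫ x in (0 : ℝ)..1, (2 * x + 4 * x ^ 3) / 7 * (Real.log (y + x) - Real.log (y - x)) =
      (1 - y ^ 2) * (2 + y ^ 2) / 7 * (Real.log (1 + y) - Real.log (1 - y)) +
        2 * y / 7 * (4 / 3 + y ^ 2) := by
  have key := MeasureTheory.integral_eq_of_hasDerivAt_off_countable_of_le
    (fun x => (x ^ 2 - y ^ 2) * (1 + x ^ 2 + y ^ 2) / 7 * Real.log (y + x) +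
      (y + x) * (1 + x ^ 2 + y ^ 2) / 7 * ((y - x) * Real.log (y - x)) +
        2 * y / 7 * ((1 + y ^ 2) * x + x ^ 3 / 3))
    (fun x => (2 * x + 4 * x ^ 3) / 7 * (Real.log (y + x) - Real.log (y - x)))
    zero_le_one (countable_singleton y) ?_ ?_ (intervalIntegrable_log_sub_log y)
  · rw [key]
    have h3 : Real.log (y - 1) = Real.log (1 - y) := by rw [← Real.log_neg_eq_log, neg_sub]
    simp only [h3, add_zero, sub_zero, add_comm y 1]
    ring
  · have h1 : ContinuousOn (fun x => Real.log (y + x)) (Icc 0 1) :=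
      ContinuousOn.log (by fun_prop) fun x hx => by linarith [hx.1]
    have h2 : Continuous fun x => (y - x) * Real.log (y - x) :=
      Real.continuous_mul_log.comp (by fun_prop : Continuous fun x => y - x)
    fun_prop
  · rintro x ⟨hx, hxy⟩
    have hx1 : y + x ≠ 0 := by linarith [hx.1]
    have hx2 : y - x ≠ 0 := fun h => hxy (by simp; linarith)
    have hA := ((((hasDerivAt_id x).pow 2).sub_const (y ^ 2)).mul
      ((((hasDerivAt_id x).pow 2).const_add 1).add_const (y ^ 2))).div_const 7
    have hB := (((hasDerivAt_id x).const_add y).mul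
      ((((hasDerivAt_id x).pow 2).const_add 1).add_const (y ^ 2))).div_const 7
    have hC := ((hasDerivAt_id x).const_sub y).mul (((hasDerivAt_id x).const_sub y).log hx2)
    have hD := (((hasDerivAt_id x).const_mul (1 + y ^ 2)).add
      (((hasDerivAt_id x).pow 3).div_const 3)).const_mul (2 * y / 7)
    refine (((hA.mul (((hasDerivAt_id x).const_add y).log hx1)).add (hB.mul hC)).add
      hD).congr_deriv ?_
    simp only [Pi.mul_apply, Pi.pow_apply, id]
    field_simp
    ring

theorem integral_log_sub_log_le {y : ℝ} (hy : 0 < y) :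
    ∫ x in (0 : ℝ)..1, (2 * x + 4 * x ^ 3) / 7 * (Real.log (y + x) - Real.log (y - x)) ≤ y := by
  rcases lt_or_ge y 1 with h | h
  · rw [integral_log_sub_log hy]
    have h1 := one_sub_sq_mul_log_le hy.le h
    have h2 : 0 ≤ (2 + y ^ 2) / 7 := by positivity
    nlinarith [mul_le_mul_of_nonneg_left h1 h2, mul_nonneg hy.le (sq_nonneg (2 * y ^ 2 - 1))]
  · have h1 := integral_log_sub_log one_pos
    have h2 : ∫ x in (0 : ℝ)..1, (2 * x + 4 * x ^ 3) / 7 * (Real.log (y + x) - Real.log (y - x)) ≤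
        ∫ x in (0 : ℝ)..1, (2 * x + 4 * x ^ 3) / 7 * (Real.log (1 + x) - Real.log (1 - x)) := by
      refine intervalIntegral.integral_mono_on_of_le_Ioo zero_le_one
        (intervalIntegrable_log_sub_log y) (intervalIntegrable_log_sub_log 1) fun x hx => ?_
      have hx0 := hx.1
      have hx1 := hx.2
      refine mul_le_mul_of_nonneg_left ?_ (by positivity)
      rw [← Real.log_div (by linarith) (by linarith), ← Real.log_div (by linarith) (by linarith)]
      refine Real.log_le_log (div_pos (by linarith) (by linarith)) ?_
      rw [div_le_div_iff₀ (by linarith) (by linarith)]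
      nlinarith
    norm_num at h1
    linarith

theorem greenUHP_le_log_im {z w : ℂ} (hz : 0 < z.im) (hw : 0 ≤ w.im) (hne : z.im ≠ w.im) :
    greenUHP z w ≤ Real.log (z.im + w.im) - Real.log (z.im - w.im) := by
  have hzw : z ≠ w := fun h => hne (by rw [h])
  have h0 : 0 < ‖z - w‖ := norm_pos_iff.2 (sub_ne_zero.2 hzw)
  have h1 : 0 < ‖z - (starRingEnd ℂ) w‖ := h0.trans_le (norm_sub_le_norm_sub_conj hz.le hw)
  have h2 : z.im - w.im ≠ 0 := sub_ne_zero.2 hne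
  have h3 : z.im + w.im ≠ 0 := by linarith
  have hsq : (z.im - w.im) ^ 2 ≤ ‖z - w‖ ^ 2 := by
    rw [← sub_im, sq_le_sq, abs_norm]
    exact Complex.abs_im_le_norm _
  have key : Real.log (‖z - (starRingEnd ℂ) w‖ ^ 2 / ‖z - w‖ ^ 2) ≤
      Real.log ((z.im + w.im) ^ 2 / (z.im - w.im) ^ 2) := by
    refine Real.log_le_log (by positivity) ?_
    rw [div_le_div_iff₀ (by positivity) (by positivity), sq_norm_sub_conj]
    nlinarith [mul_le_mul_of_nonneg_left hsq (mul_nonneg hz.le hw)]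
  rw [Real.log_div (by positivity) (by positivity), Real.log_div (by positivity) (by positivity),
    Real.log_pow, Real.log_pow, Real.log_pow, Real.log_pow] at key
  push_cast at key
  rw [greenUHP]
  linarith

/-- The half-plane capacity is bounded below by the square of the height, for a hull that has a
measurable section over the heights in `[0, H]`. -/
theorem mul_sq_le_hcap_of_section {K : Set ℂ} (hK : IsCompact K) {w : ℝ → ℂ} (hw : Measurable w)
    (hwK : ∀ x, w x ∈ K) (him : ∀ x, 0 ≤ (w x).im) {H : ℝ} (hH : 0 < H)
    (hwH : ∀ x ∈ Ioc (0 : ℝ) 1, (w x).im = H * x) {g : ℂ → ℂ} {a : ℝ}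
    (hg : IsMappingOut K g)
    (ha : Tendsto (fun z => z * (g z - z))
      (comap (fun z : ℂ => ‖z‖) atTop ⊓ 𝓟 (UHP \ K)) (𝓝 (a : ℂ))) :
    44 / 105 * H ^ 2 ≤ a := by
  set ρ : ℝ → ℝ := fun x => H * ((2 * x + 4 * x ^ 3) / 7) with hρ
  have hρc : Continuous ρ := by fun_prop
  have hρ0 : ∀ x ∈ Ioc (0 : ℝ) 1, 0 ≤ ρ x := fun x hx => by
    have := hx.1
    positivity
  set m : Measure ℝ := (volume.restrict (Ioc (0 : ℝ) 1)).withDensity fun x => ENNReal.ofReal (ρ x)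
    with hm
  have hint : IntervalIntegrable ρ volume 0 1 := hρc.intervalIntegrable _ _
  have : IsFiniteMeasure m :=
    isFiniteMeasure_withDensity_ofReal
      ((intervalIntegrable_iff_integrableOn_Ioc_of_le zero_le_one).1 hint).2
  have hconv : ∀ f : ℝ → ℝ, ∫ x, f x ∂m = ∫ x in Ioc (0 : ℝ) 1, ρ x * f x := by
    intro f
    rw [hm, integral_withDensity_eq_integral_toReal_smul (by fun_prop) (by simp)]
    refine setIntegral_congr_fun measurableSet_Ioc fun x hx => ?_
    simp [ENNReal.toReal_ofReal (hρ0 x hx)]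
  have hpot : ∀ z ∈ UHP \ K, ∫ x, greenUHP z (w x) ∂m ≤ z.im := by
    intro z hz
    have hzim : 0 < z.im := hz.1
    have hint := intervalIntegrable_log_sub_log (z.im / H)
    rw [intervalIntegrable_iff_integrableOn_Ioc_of_le zero_le_one] at hint
    have hle := integral_log_sub_log_le (div_pos hzim hH)
    rw [intervalIntegral.integral_of_le zero_le_one, le_div_iff₀ hH, mul_comm,
      ← integral_const_mul] at hle
    rw [hconv]
    refine le_trans (integral_mono_of_nonneg ?_ (hint.const_mul H) ?_) hle
    · filter_upwards [ae_restrict_mem measurableSet_Ioc] with x hx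
      exact mul_nonneg (hρ0 x hx) (greenUHP_nonneg hzim.le (him x) fun h => hz.2 (h ▸ hwK x))
    · filter_upwards [ae_restrict_mem measurableSet_Ioc,
        ae_restrict_of_ae (Measure.ae_ne volume (z.im / H))] with x hx hne
      have hx0 := hx.1
      have h1 : z.im / H - x ≠ 0 := sub_ne_zero.2 (Ne.symm hne)
      have h2 : z.im / H + x ≠ 0 := by positivity
      have h3 : z.im - H * x = H * (z.im / H - x) := by field_simp
      have h4 : z.im + H * x = H * (z.im / H + x) := by field_simp
      have h5 : z.im ≠ (w x).im := by
        rw [hwH x hx, ← sub_ne_zero, h3]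
        exact mul_ne_zero hH.ne' h1
      have h6 := greenUHP_le_log_im hzim (him x) h5
      rw [hwH x hx, h3, h4, Real.log_mul hH.ne' h1, Real.log_mul hH.ne' h2,
        add_sub_add_left_eq_sub] at h6
      rw [← mul_assoc]
      exact mul_le_mul_of_nonneg_left h6 (hρ0 x hx)
  have hres := two_mul_integral_im_le_hcap hK hw hwK him hpot hg ha
  have hmom : ∫ x, (w x).im ∂m = 22 / 105 * H ^ 2 := by
    rw [hconv]
    have h1 : ∫ x in Ioc (0 : ℝ) 1, ρ x * (w x).im =
        ∫ x in Ioc (0 : ℝ) 1, (H ^ 2 / 7) * (2 * x ^ 2 + 4 * x ^ 4) := by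
      refine setIntegral_congr_fun measurableSet_Ioc fun x hx => ?_
      simp only [hwH x hx, hρ]
      ring
    rw [h1, ← intervalIntegral.integral_of_le zero_le_one, intervalIntegral.integral_const_mul,
      intervalIntegral.integral_add (Continuous.intervalIntegrable (by fun_prop) _ _)
        (Continuous.intervalIntegrable (by fun_prop) _ _),
      intervalIntegral.integral_const_mul, intervalIntegral.integral_const_mul,
      integral_pow, integral_pow]
    ring
  linarith

theorem exists_measurable_section {η : ℝ → ℂ} {s : ℝ} (hs : 0 ≤ s) (hη : ContinuousOn η (Icc 0 s))
    (h0 : (η 0).im = 0) (hH : 0 ≤ (η s).im) :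
    ∃ w : ℝ → ℂ, Measurable w ∧ (∀ x, w x ∈ η '' Icc 0 s) ∧
      ∀ x ∈ Ioc (0 : ℝ) 1, (w x).im = (η s).im * x := by
  set A : ℝ → Set ℝ := fun x => Icc 0 s ∩ {v | (η v).im ≤ (η s).im * x} with hA
  have hbdd : ∀ x, BddAbove (A x) := fun x => bddAbove_Icc.mono inter_subset_left
  have himc : ContinuousOn (fun v => (η v).im) (Icc 0 s) := Complex.continuous_im.comp_continuousOn hη
  have hmono : Monotone fun x => sSup (A x) := by
    intro x y hxy
    rcases (A x).eq_empty_or_nonempty with h | h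
    · simp only [h, Real.sSup_empty]
      exact Real.sSup_nonneg fun v hv => hv.1.1
    · exact csSup_le_csSup (hbdd y) h fun v hv =>
        ⟨hv.1, hv.2.trans (mul_le_mul_of_nonneg_left hxy hH)⟩
  refine ⟨fun x => IccExtend hs ((Icc 0 s).domRestrict η) (sSup (A x)),
    hη.domRestrict.Icc_extend'.measurable.comp hmono.measurable,
    fun x => ⟨_, (projIcc 0 s hs (sSup (A x))).2, rfl⟩, fun x hx => ?_⟩
  have hx0 : 0 ≤ (η s).im * x := mul_nonneg hH hx.1.le
  have hne : (A x).Nonempty := ⟨0, ⟨le_rfl, hs⟩, h0.trans_le hx0⟩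
  have hcl : IsClosed (A x) := himc.preimage_isClosed_of_isClosed isClosed_Icc isClosed_Iic
  obtain ⟨hmem, hle⟩ := hcl.csSup_mem hne (hbdd x)
  simp only [IccExtend_of_mem hs _ hmem]
  change (η (sSup (A x))).im = (η s).im * x
  refine le_antisymm hle ?_
  have hivt := intermediate_value_Icc hmem.2
    (himc.mono (Icc_subset_Icc_left hmem.1))
  obtain ⟨v, hv, hvx⟩ := hivt ⟨hle, mul_le_of_le_one_right hH hx.2⟩
  have hvA : v ∈ A x := ⟨⟨hmem.1.trans hv.1, hv.2⟩, hvx.le⟩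
  have hveq : sSup (A x) = v := le_antisymm hv.1 (le_csSup (hbdd x) hvA)
  rw [hveq]
  exact hvx.ge

theorem sqrtH_sq (z : ℂ) : sqrtH z ^ 2 = z := by
  have : ((-z) ^ ((1 : ℂ) / 2)) ^ 2 = -z := by simp
  rw [sqrtH, mul_pow, this, I_sq]
  ring

theorem sqrtH_im_nonneg (z : ℂ) : 0 ≤ (sqrtH z).im := by
  have him : (sqrtH z).im = ((-z) ^ ((1 : ℂ) / 2)).re := by simp [sqrtH]
  rw [him]
  rcases eq_or_ne z 0 with rfl | h
  · simp
  · rw [Complex.cpow_def_of_ne_zero (neg_ne_zero.2 h), Complex.exp_re]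
    have h1 : (Complex.log (-z) * (1 / 2)).im = (-z).arg / 2 := by
      rw [show (1 / 2 : ℂ) = ((1 / 2 : ℝ) : ℂ) by simp, Complex.im_mul_ofReal, Complex.log_im]
      ring
    rw [h1]
    refine mul_nonneg (Real.exp_pos _).le (Real.cos_nonneg_of_mem_Icc ⟨?_, ?_⟩)
    · linarith [Complex.neg_pi_lt_arg (-z)]
    · linarith [Complex.arg_le_pi (-z)]

theorem norm_sqrtH_sq (z : ℂ) : ‖sqrtH z‖ ^ 2 = ‖z‖ := by
  rw [← norm_pow, sqrtH_sq]

theorem neg_re_le_sqrtH_im_sq (z : ℂ) : -z.re ≤ (sqrtH z).im ^ 2 := by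
  have h := congrArg Complex.re (sqrtH_sq z)
  rw [sq, Complex.mul_re] at h
  nlinarith [sq_nonneg (sqrtH z).re]

theorem continuousAt_sqrtH {z : ℂ} (hz : z.re ≤ 0) : ContinuousAt sqrtH z := by
  have h : ContinuousAt (fun x : ℂ => x ^ ((1 : ℂ) / 2)) (-z) :=
    Complex.continuousAt_cpow_const_of_re_pos (Or.inl (by simpa using hz)) (by norm_num)
  exact continuousAt_const.mul (ContinuousAt.comp (f := fun z : ℂ => -z) h continuousAt_neg)

theorem re_le_neg_of_norm_sub_le {v : ℂ} (hv : ‖v‖ = 1) (h : ‖v - (-1)‖ ≤ 1 / 5) :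
    v.re ≤ -(49 / 50) := by
  have h1 : ‖v - (-1)‖ ^ 2 ≤ (1 / 5) ^ 2 := by gcongr
  have h2 : ‖v‖ ^ 2 = 1 := by rw [hv, one_pow]
  rw [← normSq_eq_norm_sq, normSq_apply] at h1 h2
  simp at h1
  nlinarith

/-- For an `R`-regular, arclength-parametrized `C^1` simple curve `γ`
tangentially attached to `ℝ₊` with `ω(R) ≤ 1/5`, the half-plane capacity
parametrization `t(s)` of `η = √γ` satisfies `s/5 ≤ t(s) ≤ s/2` for `s ∈ [0,R]`. -/
theorem capacity_comparison (S R : ℝ) (hS : 0 < S) (hR : 0 < R) (hRS : R ≤ S)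
    (γ γ' : ℝ → ℂ) (ω : ℝ → ℝ) (t : ℝ → ℝ)
    (hωmono : ∀ a b : ℝ, 0 ≤ a → a ≤ b → ω a ≤ ω b)
    (hderiv : ∀ s ∈ Set.Icc (0:ℝ) S, HasDerivWithinAt γ (γ' s) (Set.Icc 0 S) s)
    (hunit : ∀ s ∈ Set.Icc (0:ℝ) S, ‖γ' s‖ = 1)
    (hmod : ∀ s ∈ Set.Icc (0:ℝ) S, ∀ s' ∈ Set.Icc (0:ℝ) S,
      ‖γ' s - γ' s'‖ ≤ ω |s - s'|)
    (hγ0 : γ 0 = 0) (hγ'0 : γ' 0 = -1)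
    (hinj : Set.InjOn γ (Set.Icc 0 S))
    (havoid : ∀ s ∈ Set.Ioc (0:ℝ) S, ¬ (0 ≤ (γ s).re ∧ (γ s).im = 0))
    (hreg : ∀ s ∈ Set.Icc (0:ℝ) S, ∀ r : ℝ, 0 < r → r ≤ R →
      IsConnected (Metric.closedBall (γ s) r ∩
        ((fun u : ℝ => if 0 ≤ u then γ u else ((-u : ℝ) : ℂ)) '' Set.Iic S)))
    (hωR : ω R ≤ 1/5)
    (hcap : ∀ s ∈ Set.Icc (0:ℝ) S,
      HasHCap ((fun u => sqrtH (γ u)) '' Set.Icc 0 s) (2 * t s)) :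
    ∀ s ∈ Set.Icc (0:ℝ) R, s / 5 ≤ t s ∧ t s ≤ s / 2 := by
  have hsub : Icc 0 R ⊆ Icc 0 S := Icc_subset_Icc_right hRS
  have hderivR : ∀ u ∈ Icc 0 R, HasDerivWithinAt γ (γ' u) (Icc 0 R) u :=
    fun u hu => (hderiv u (hsub hu)).mono hsub
  have hR0 : (0 : ℝ) ∈ Icc 0 R := ⟨le_rfl, hR.le⟩
  have hnorm : ∀ u ∈ Icc 0 R, ‖γ u‖ ≤ u := by
    intro u hu
    have := (convex_Icc 0 R).norm_image_sub_le_of_norm_hasDerivWithin_le hderivR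
      (fun u hu => (hunit u (hsub hu)).le) hR0 hu
    simpa [hγ0, abs_of_nonneg hu.1] using this
  have hre : ∀ u ∈ Icc 0 R, (γ u).re ≤ -(49 / 50) * u := by
    intro u hu
    have hder : ∀ v ∈ Icc 0 R,
        HasDerivWithinAt (fun v => -(49 / 50) * v - (γ v).re) (-(49 / 50) - (γ' v).re)
          (Icc 0 R) v := fun v hv =>
      (by simpa using (hasDerivWithinAt_id v _).const_mul (-(49 / 50) : ℝ) :
        HasDerivWithinAt (fun v => -(49 / 50) * v) (-(49 / 50)) (Icc 0 R) v).sub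
        (Complex.reCLM.hasFDerivAt.comp_hasDerivWithinAt v (hderivR v hv))
    have hmono : MonotoneOn (fun v => -(49 / 50) * v - (γ v).re) (Icc 0 R) := by
      refine monotoneOn_of_hasDerivWithinAt_nonneg (convex_Icc 0 R)
        (fun v hv => (hder v hv).continuousWithinAt)
        (fun v hv => (hder v (interior_subset hv)).mono interior_subset) fun v hv => ?_
      have hv := interior_subset hv
      have h1 := hmod v (hsub hv) 0 (hsub hR0)
      rw [hγ'0, sub_zero, abs_of_nonneg hv.1] at h1
      have h2 := re_le_neg_of_norm_sub_le (hunit v (hsub hv))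
        ((h1.trans (hωmono v R hv.1 hv.2)).trans hωR)
      linarith
    have := hmono hR0 hu hu.1
    simp [hγ0] at this
    linarith
  intro s hs
  have hsubs : Icc 0 s ⊆ Icc 0 R := Icc_subset_Icc_right hs.2
  have hη : ContinuousOn (fun u => sqrtH (γ u)) (Icc 0 s) := by
    intro u hu
    have hu0 : (γ u).re ≤ 0 := by linarith [hre u (hsubs hu), hu.1]
    exact (continuousAt_sqrtH hu0).comp_continuousWithinAt
      ((hderivR u (hsubs hu)).continuousWithinAt.mono hsubs)
  have hK : IsCompact ((fun u => sqrtH (γ u)) '' Icc 0 s) := isCompact_Icc.image_of_continuousOn hη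
  obtain ⟨g, hg, hlim⟩ := hcap s (hsub hs)
  have hlim : Tendsto (fun z => z * (g z - z)) (comap (fun z : ℂ => ‖z‖) atTop ⊓
      𝓟 (UHP \ (fun u => sqrtH (γ u)) '' Icc 0 s)) (𝓝 ((2 * t s : ℝ) : ℂ)) := by
    simpa using hlim
  have hupper : 2 * t s ≤ s := by
    have := hcap_le_sq (Real.sqrt_nonneg s) ?_ hg hlim
    · rwa [Real.sq_sqrt hs.1] at this
    · rintro _ ⟨u, hu, rfl⟩
      rw [mem_closedBall_zero_iff]
      refine Real.le_sqrt_of_sq_le ?_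
      rw [norm_sqrtH_sq]
      exact (hnorm u (hsubs hu)).trans hu.2
  have him : ∀ z ∈ (fun u => sqrtH (γ u)) '' Icc 0 s, 0 ≤ z.im := by
    rintro _ ⟨u, -, rfl⟩
    exact sqrtH_im_nonneg _
  have hlower : 44 / 105 * (sqrtH (γ s)).im ^ 2 ≤ 2 * t s := by
    obtain ⟨w, hw, hwK, hwH⟩ := exists_measurable_section hs.1 hη (by simp [hγ0, sqrtH])
      (sqrtH_im_nonneg _)
    rcases (sqrtH_im_nonneg (γ s)).eq_or_lt with h | h
    · have := two_mul_integral_im_le_hcap (m := (0 : Measure ℝ)) hK hw hwK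
        (fun x => him _ (hwK x)) (fun z hz => by simpa using (show 0 < z.im from hz.1).le) hg hlim
      simpa [← h] using this
    · exact mul_sq_le_hcap_of_section hK hw hwK (fun x => him _ (hwK x)) h hwH hg hlim
  have h1 := neg_re_le_sqrtH_im_sq (γ s)
  have h2 := hre s hs
  have h3 := hs.1
  constructor <;> linarith
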